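/- Consider T independent steps, where at step t a probability vector p^(t) ∈ (0,1)^N with Σ_k p^(t)_k = 1 is given, a green list G_t of size γN is sampled uniformly at random from subsets of {1,…,N} (independently across steps), the green list logits are boosted by δ > 0 (α = exp(δ)) to form the watermarked distribution p̂^(t), and a token s^(t) is sampled from p̂^(t). Let |s|_G = #{t : s^(t) ∈ G_t} denote the number of green list tokens. If the average spike entropy satisfies (1/T) Σ_t S(p^(t), (1-γ)(α-1)/(1+(α-1)γ)) ≥ S★, then E|s|_G ≥ (γαT/(1+(α-1)γ)) · S★. -/

import Mathlib

open scoped BigOperators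

/-- The spike entropy of a probability vector `p` with modulus `z`:
`S(p,z) = ∑ k, p k / (1 + z * p k)`. -/
noncomputable def spikeEntropy {N : ℕ} (p : Fin N → ℝ) (z : ℝ) : ℝ :=
  ∑ k, p k / (1 + z * p k)

/-- The probability that a token sampled from the watermarked distribution (obtained from `p`
by boosting the logits of a uniformly random green list of size `m` by `δ = ln α`) lies in the
green list: the average over all green lists `G` of size `m` of the watermarked mass of `G`. -/
noncomputable def greenProb {N : ℕ} (p : Fin N → ℝ) (m : ℕ) (α : ℝ) : ℝ :=
  (∑ G ∈ Finset.powersetCard m (Finset.univ : Finset (Fin N)),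
      ∑ k ∈ G, α * p k / ((∑ i ∈ Gᶜ, p i) + α * ∑ i ∈ G, p i)) /
    (Finset.powersetCard m (Finset.univ : Finset (Fin N))).card

/-- The subsets of `{1, …, N}` of size `m` containing a fixed element make up a fraction `m / N`
of all subsets of size `m`. -/
lemma card_mul_card_filter_mem_powersetCard {N m : ℕ} (hm : 0 < m) (k : Fin N) :
    N * ((Finset.powersetCard m (Finset.univ : Finset (Fin N))).filter (k ∈ ·)).card =
      m * (Finset.powersetCard m (Finset.univ : Finset (Fin N))).card := by
  have h := Finset.card_filter_powersetCard_subset {k} (Finset.univ : Finset (Fin N)) m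
    (Finset.subset_univ _) (by rwa [Finset.card_singleton])
  simp only [Finset.singleton_subset_iff, Finset.card_univ, Fintype.card_fin,
    Finset.card_singleton] at h
  rw [h, Finset.card_powersetCard, Finset.card_univ, Fintype.card_fin]
  obtain ⟨m, rfl⟩ := Nat.exists_eq_add_of_lt hm
  obtain ⟨N, rfl⟩ := Nat.exists_eq_add_of_lt k.pos
  simp only [zero_add, Nat.add_sub_cancel]
  rw [Nat.add_one_mul_choose_eq, mul_comm]

/-- Negative correlation of membership in a uniformly random subset of size `m`: among the subsets
containing `k`, at most a fraction `m / N` contains another element `i`. -/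
lemma card_mul_card_filter_mem_mem_powersetCard_le {N m : ℕ} (hmN : m ≤ N)
    {k i : Fin N} (hik : i ≠ k) :
    N * (((Finset.powersetCard m (Finset.univ : Finset (Fin N))).filter (k ∈ ·)).filter
        (i ∈ ·)).card ≤
      m * ((Finset.powersetCard m (Finset.univ : Finset (Fin N))).filter (k ∈ ·)).card := by
  have hcard : ({k, i} : Finset (Fin N)).card = 2 := Finset.card_pair hik.symm
  rcases lt_or_ge m 2 with hm | hm
  · rw [Finset.card_eq_zero.mpr, mul_zero]
    · exact Nat.zero_le _
    · refine Finset.filter_eq_empty_iff.mpr fun G hG hi => ?_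
      obtain ⟨hG, hk⟩ := Finset.mem_filter.mp hG
      have := Finset.card_le_card
        (Finset.insert_subset_iff.mpr ⟨hk, Finset.singleton_subset_iff.mpr hi⟩)
      rw [hcard, (Finset.mem_powersetCard.mp hG).2] at this
      lia
  · have hone := Finset.card_filter_powersetCard_subset {k} (Finset.univ : Finset (Fin N)) m
      (Finset.subset_univ _) (by rw [Finset.card_singleton]; lia)
    have htwo := Finset.card_filter_powersetCard_subset {k, i} (Finset.univ : Finset (Fin N)) m
      (Finset.subset_univ _) (by rwa [hcard])
    simp only [Finset.singleton_subset_iff, Finset.card_univ, Fintype.card_fin,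
      Finset.card_singleton] at hone
    simp only [Finset.insert_subset_iff, Finset.singleton_subset_iff, Finset.card_univ,
      Fintype.card_fin, hcard] at htwo
    rw [Finset.filter_filter, hone, htwo]
    obtain ⟨m, rfl⟩ := Nat.exists_eq_add_of_le' hm
    obtain ⟨N, rfl⟩ := Nat.exists_eq_add_of_le' (hm.trans hmN)
    have h := Nat.add_one_mul_choose_eq N m
    simp only [Nat.add_sub_cancel, show m + 2 - 1 = m + 1 from rfl, show N + 2 - 1 = N + 1 from rfl]
    refine Nat.le_of_mul_le_mul_left ?_ (Nat.succ_pos N)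
    calc (N + 1) * ((N + 2) * N.choose m)
        = (N + 2) * (m + 1) * (N + 1).choose (m + 1) := by
          rw [mul_left_comm, h]; ring
      _ ≤ (N + 1) * (m + 2) * (N + 1).choose (m + 1) := by
          gcongr ?_ * _
          nlinarith
      _ = (N + 1) * ((m + 2) * (N + 1).choose (m + 1)) := by ring

/-- Jensen's inequality for `x ↦ x⁻¹`, with an upper bound on the mean. -/
lemma card_div_le_sum_inv {ι : Type*} (s : Finset ι) (x : ι → ℝ) {c : ℝ} (hc : 0 < c)
    (hx : ∀ i ∈ s, 0 < x i) (hsum : ∑ i ∈ s, x i ≤ s.card * c) :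
    s.card / c ≤ ∑ i ∈ s, (x i)⁻¹ := by
  have htangent : ∀ i ∈ s, 2 / c - x i / c ^ 2 ≤ (x i)⁻¹ := by
    intro i hi
    have hxi := hx i hi
    have : (x i)⁻¹ - (2 / c - x i / c ^ 2) = (c - x i) ^ 2 / (x i * c ^ 2) := by
      field_simp
      ring
    linarith [show 0 ≤ (c - x i) ^ 2 / (x i * c ^ 2) by positivity]
  calc (s.card : ℝ) / c = s.card * (2 / c) - s.card * c / c ^ 2 := by
        field_simp
        ring
    _ ≤ s.card * (2 / c) - (∑ i ∈ s, x i) / c ^ 2 := by gcongr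
    _ = ∑ i ∈ s, (2 / c - x i / c ^ 2) := by
        rw [Finset.sum_sub_distrib, Finset.sum_const, nsmul_eq_mul, Finset.sum_div]
    _ ≤ _ := Finset.sum_le_sum htangent

/-- Conditionally on `k` being green, the mean mass of a uniformly random green list of size `γN`
is at most `γ + (1 - γ) p k`. -/
lemma sum_mass_filter_mem_powersetCard_le {N m : ℕ} {p : Fin N → ℝ} (hp : ∀ k, 0 ≤ p k)
    (hsum : ∑ k, p k = 1) {γ : ℝ} (hγ : γ ≤ 1) (hm : (m : ℝ) = γ * N) (k : Fin N) :
    ∑ G ∈ (Finset.powersetCard m (Finset.univ : Finset (Fin N))).filter (k ∈ ·), ∑ i ∈ G, p i ≤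
      ((Finset.powersetCard m (Finset.univ : Finset (Fin N))).filter (k ∈ ·)).card *
        (γ + (1 - γ) * p k) := by
  set A := (Finset.powersetCard m (Finset.univ : Finset (Fin N))).filter (k ∈ ·) with hA
  have hN : (0 : ℝ) < N := by exact_mod_cast k.pos
  have hmN : m ≤ N := by
    have : (m : ℝ) ≤ N := by rw [hm]; nlinarith
    exact_mod_cast this
  have hswap : ∑ G ∈ A, ∑ i ∈ G, p i = ∑ i, (A.filter (i ∈ ·)).card * p i := by
    simp_rw [← nsmul_eq_mul, ← Finset.sum_const]
    exact Finset.sum_comm' (by simp [and_comm])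
  have hk : A.filter (k ∈ ·) = A := by simp [hA, Finset.filter_filter]
  have hrest : ∑ i ∈ Finset.univ.erase k, p i = 1 - p k := by
    rw [← hsum, ← Finset.add_sum_erase _ _ (Finset.mem_univ k)]
    ring
  rw [hswap, ← Finset.add_sum_erase _ _ (Finset.mem_univ k), hk]
  calc _ ≤ A.card * p k + ∑ i ∈ Finset.univ.erase k, γ * A.card * p i := by
        gcongr with i hi
        · exact hp i
        · have h : (N : ℝ) * (A.filter (i ∈ ·)).card ≤ m * A.card := by
            exact_mod_cast card_mul_card_filter_mem_mem_powersetCard_le hmN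
              (Finset.ne_of_mem_erase hi)
          rw [hm] at h
          exact le_of_mul_le_mul_left (h.trans_eq (by ring)) hN
    _ = _ := by
        rw [← Finset.mul_sum, hrest]
        ring

/-- A token sampled from the watermarked distribution of `p` is green with probability at least
`γα / (1 + (α - 1)γ)` times the spike entropy of `p`. -/
lemma mul_spikeEntropy_le_greenProb {N m : ℕ} {p : Fin N → ℝ} (hp : ∀ k, 0 ≤ p k)
    (hsum : ∑ k, p k = 1) {γ : ℝ} (hγ : γ ∈ Set.Ioo (0 : ℝ) 1) (hm : (m : ℝ) = γ * N)
    {α : ℝ} (hα : 1 < α) :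
    γ * α / (1 + (α - 1) * γ) * spikeEntropy p ((1 - γ) * (α - 1) / (1 + (α - 1) * γ)) ≤
      greenProb p m α := by
  obtain ⟨hγ0, hγ1⟩ := hγ
  have hα' : 0 < α - 1 := sub_pos.mpr hα
  set P := Finset.powersetCard m (Finset.univ : Finset (Fin N)) with hP
  have hden : ∀ G : Finset (Fin N),
      (∑ i ∈ Gᶜ, p i) + α * ∑ i ∈ G, p i = 1 + (α - 1) * ∑ i ∈ G, p i := by
    intro G
    have h := Finset.sum_add_sum_compl G p
    rw [hsum] at h
    linear_combination h
  have hgreen : greenProb p m α =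
      ∑ k, α * p k * (∑ G ∈ P.filter (k ∈ ·), (1 + (α - 1) * ∑ i ∈ G, p i)⁻¹) / P.card := by
    unfold greenProb
    simp_rw [hden, div_eq_mul_inv (α * _)]
    rw [← hP, Finset.sum_comm' (t' := Finset.univ) (s' := fun k => P.filter (k ∈ ·))
      (by simp)]
    simp_rw [← Finset.sum_div, Finset.mul_sum]
  rw [hgreen, spikeEntropy, Finset.mul_sum]
  refine Finset.sum_le_sum fun k _ => ?_
  have hN : (0 : ℝ) < N := by exact_mod_cast k.pos
  have hm0 : 0 < m := by
    have : (0 : ℝ) < m := by rw [hm]; positivity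
    exact_mod_cast this
  have hmN : m ≤ N := by
    have : (m : ℝ) ≤ N := by rw [hm]; nlinarith
    exact_mod_cast this
  have hPpos : (0 : ℝ) < P.card := by
    rw [hP, Finset.card_powersetCard, Finset.card_univ, Fintype.card_fin]
    exact_mod_cast Nat.choose_pos hmN
  have hcard : ((P.filter (k ∈ ·)).card : ℝ) = γ * P.card := by
    have h : (N : ℝ) * (P.filter (k ∈ ·)).card = m * P.card := by
      exact_mod_cast card_mul_card_filter_mem_powersetCard hm0 k
    rw [hm] at h
    exact mul_left_cancel₀ hN.ne' (h.trans (by ring))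
  have hγ' : 0 < 1 - γ := sub_pos.mpr hγ1
  have hpk := hp k
  have hc : 0 < 1 + (α - 1) * (γ + (1 - γ) * p k) := by positivity
  have hjensen := card_div_le_sum_inv (P.filter (k ∈ ·)) (fun G => 1 + (α - 1) * ∑ i ∈ G, p i) hc
    (fun G _ => by have := Finset.sum_nonneg fun i (_ : i ∈ G) => hp i; positivity) (by
      have h := sum_mass_filter_mem_powersetCard_le hp hsum hγ1.le hm k
      rw [Finset.sum_add_distrib, ← Finset.mul_sum, Finset.sum_const, nsmul_one]
      calc _ ≤ _ := add_le_add_right (mul_le_mul_of_nonneg_left h hα'.le) _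
        _ = _ := by ring)
  rw [hcard] at hjensen
  calc _ = α * p k * (γ * P.card / (1 + (α - 1) * (γ + (1 - γ) * p k))) / P.card := by
        have hd : 0 < 1 + (α - 1) * γ := by positivity
        have he : 1 + (1 - γ) * (α - 1) / (1 + (α - 1) * γ) * p k =
            (1 + (α - 1) * (γ + (1 - γ) * p k)) / (1 + (α - 1) * γ) := by
          field_simp
          ring
        rw [he]
        field_simp
    _ ≤ _ := by gcongr

/-- Over `T` independent steps, each sampling a token from the watermarked distribution of
`p^(t)` with a fresh uniformly random green list of size `γN`, the expected number of green
list tokens, `E|s|_G = ∑_t P[s^(t) ∈ G_t]`, satisfies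
`E|s|_G ≥ (γαT/(1+(α-1)γ)) · S★` whenever the average spike entropy
`(1/T) ∑_t S(p^(t), (1-γ)(α-1)/(1+(α-1)γ))` is at least `S★`. -/
theorem expected_green_count_ge (N T : ℕ) (p : Fin T → Fin N → ℝ)
    (hp : ∀ t k, p t k ∈ Set.Ioo (0 : ℝ) 1) (hsum : ∀ t, ∑ k, p t k = 1)
    (γ : ℝ) (hγ : γ ∈ Set.Ioo (0 : ℝ) 1)
    (m : ℕ) (hm : (m : ℝ) = γ * N)
    (δ : ℝ) (hδ : 0 < δ) (α : ℝ) (hα : α = Real.exp δ)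
    (Sstar : ℝ)
    (hS : Sstar ≤ (1 / T) *
      ∑ t, spikeEntropy (p t) ((1 - γ) * (α - 1) / (1 + (α - 1) * γ))) :
    γ * α * T / (1 + (α - 1) * γ) * Sstar ≤ ∑ t, greenProb (p t) m α := by
  rcases Nat.eq_zero_or_pos T with rfl | hT
  · simp
  have hα1 : 1 < α := hα ▸ Real.one_lt_exp_iff.mpr hδ
  have hT' : (0 : ℝ) < T := by exact_mod_cast hT
  have hc : 0 ≤ γ * α * T / (1 + (α - 1) * γ) := by
    have := hγ.1
    have := sub_pos.mpr hα1
    positivity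
  calc _ ≤ γ * α * T / (1 + (α - 1) * γ) * ((1 / T) *
        ∑ t, spikeEntropy (p t) ((1 - γ) * (α - 1) / (1 + (α - 1) * γ))) := by gcongr
    _ = ∑ t, γ * α / (1 + (α - 1) * γ) *
        spikeEntropy (p t) ((1 - γ) * (α - 1) / (1 + (α - 1) * γ)) := by
        rw [← Finset.mul_sum, ← mul_assoc]
        congr 1
        field_simp
    _ ≤ _ := Finset.sum_le_sum fun t _ =>
        mul_spikeEntropy_le_greenProb (fun k => (hp t k).1.le) (hsum t) hγ hm hα1
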